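/- arXiv:2309.01882 — 2 statements merged into one kernel-verified Lean document; each statement's English description precedes it below -/
import Mathlib

section
/- Let d ∈ ℕ, n ∈ ℕ, p ∈ S_d^o with p_{d+1} := 1 − ‖p‖₁, and let k ∈ ℝ^d with k_{d+1} := n − ‖k‖₁. Using the inverse formula Σ_p^{−1} = diag(p^{−1}) + p_{d+1}^{−1} 1_d 1_dᵀ, the normalized quadratic form equals Pearson's chi-square statistic: δ_{k,p}ᵀ Σ_p^{−1} δ_{k,p} = Σ_{i=1}^{d+1} (k_i − n p_i)² / (n p_i). -/
open MeasureTheory Matrix Real Finset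
open scoped BigOperators ENNReal NNReal

noncomputable section

/-- Extended probability vector: `p` on `Fin d`, together with `p (d+1) = 1 - ∑ p`. -/
def extP (d : ℕ) (p : Fin d → ℝ) : Fin (d + 1) → ℝ :=
  Fin.snoc p (1 - ∑ i, p i)

/-- Extended coordinate vector: `v` on `Fin d`, together with `v (d+1) = n - ∑ v`. -/
def extV (d n : ℕ) (v : Fin d → ℝ) : Fin (d + 1) → ℝ :=
  Fin.snoc v ((n : ℝ) - ∑ i, v i)

/-- `δ_{y,q} = (y - n q) / √n`. -/
def del (n : ℕ) (q y : ℝ) : ℝ := (y - n * q) / Real.sqrt n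

/-- The vector `δ_{v,p}`. -/
def delVec (d n : ℕ) (p v : Fin d → ℝ) : Fin d → ℝ := fun i => del n (p i) (v i)

/-- The covariance matrix `Σ_p = diag p - p pᵀ`. -/
def covM (d : ℕ) (p : Fin d → ℝ) : Matrix (Fin d) (Fin d) ℝ :=
  Matrix.diagonal p - Matrix.vecMulVec p p

/-- The quadratic form `x ↦ xᵀ Σ_p⁻¹ x`. -/
def quadForm (d : ℕ) (p x : Fin d → ℝ) : ℝ := x ⬝ᵥ ((covM d p)⁻¹ *ᵥ x)

/-- The Gaussian density `φ_{Σ_p}`. -/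
def gaussDens (d : ℕ) (p y : Fin d → ℝ) : ℝ :=
  Real.exp (-(1 / 2) * quadForm d p y) /
    Real.sqrt ((2 * Real.pi) ^ d * ∏ i, extP d p i)

/-- The `Multinomial(n, p)` probability mass function. -/
def multinomialPMF (d n : ℕ) (p : Fin d → ℝ) (k : Fin d → ℕ) : ℝ :=
  if ∑ i, k i ≤ n then
    ((n.factorial : ℝ) / ((∏ i, ((k i).factorial : ℝ)) * ((n - ∑ i, k i).factorial : ℝ))) *
      ((∏ i, p i ^ k i) * (1 - ∑ i, p i) ^ (n - ∑ i, k i))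
  else 0

/-- The interior `S_d^o` of the unit simplex. -/
def simplexInt (d : ℕ) : Set (Fin d → ℝ) :=
  {s | (∀ i, s i ∈ Set.Ioo (0 : ℝ) 1) ∧ ∑ i, s i < 1}

/-- The set `P_τ`. -/
def Ptau (d : ℕ) (τ : ℝ) : Set (Fin d → ℝ) :=
  {s | s ∈ simplexInt d ∧ ∀ i : Fin (d + 1), (extP d s i)⁻¹ ≤ τ}

/-- Cast a vector of naturals to a real vector. -/
def castK (d : ℕ) (k : Fin d → ℕ) : Fin d → ℝ := fun i => (k i : ℝ)

/-- The bulk set `B_{n,p}` (integer vectors). -/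
def bulk (d n : ℕ) (τ : ℝ) (p : Fin d → ℝ) : Set (Fin d → ℕ) :=
  {k | (∀ i, 0 < k i) ∧ ∑ i, k i < n ∧
    ∀ i : Fin (d + 1),
      |del n (extP d p i) (extV d n (castK d k) i) / (Real.sqrt n * extP d p i)| ≤
        τ * Real.sqrt (Real.log n / n)}

/-- The bulk set `B_{n,p}` (real vectors). -/
def bulkReal (d n : ℕ) (τ : ℝ) (p : Fin d → ℝ) : Set (Fin d → ℝ) :=
  {x | ∀ i : Fin (d + 1),
    |del n (extP d p i) (extV d n x i) / (Real.sqrt n * extP d p i)| ≤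
      τ * Real.sqrt (Real.log n / n)}

/-- The main term in the local expansion. -/
def mainTerm (d n : ℕ) (p v : Fin d → ℝ) : ℝ :=
  (n : ℝ) ^ (-(1 : ℝ) / 2) * ∑ i : Fin (d + 1),
    (del n (extP d p i) (extV d n v i) ^ 3 / (6 * extP d p i ^ 2) -
      del n (extP d p i) (extV d n v i) / (2 * extP d p i))

/-- The bound on the remainder `R_{n,p}(k)`. -/
def errBound (d n : ℕ) (τ : ℝ) (p v : Fin d → ℝ) : ℝ :=
  (n : ℝ)⁻¹ * ∑ i : Fin (d + 1),
    (21 * |del n (extP d p i) (extV d n v i)| ^ 4 / extP d p i ^ 3 +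
      10 * |del n (extP d p i) (extV d n v i)| ^ 2 / extP d p i ^ 2 + 2 * τ / 3)

/-- The log-ratio of the multinomial pmf over the corresponding normal density. -/
def logRatio (d n : ℕ) (p : Fin d → ℝ) (k : Fin d → ℕ) : ℝ :=
  Real.log (multinomialPMF d n p k /
    ((n : ℝ) ^ (-(d : ℝ) / 2) * gaussDens d p (delVec d n p (castK d k))))

/-- The law of a `Multinomial(n,p)` random vector, as a measure on `ℝ^d`. -/
def multinomialLaw (d n : ℕ) (p : Fin d → ℝ) : Measure (Fin d → ℝ) :=
  Measure.sum fun k : Fin d → ℕ =>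
    ENNReal.ofReal (multinomialPMF d n p k) • Measure.dirac (castK d k)

/-- The law of a `Uniform(-1/2,1/2)^d` random vector. -/
def uniformBoxLaw (d : ℕ) : Measure (Fin d → ℝ) :=
  volume.restrict (Set.univ.pi fun _ : Fin d => Set.Ioo (-(1 : ℝ) / 2) (1 / 2))

/-- The law of a `Normal_d (n p, n Σ_p)` random vector. -/
def gaussLaw (d n : ℕ) (p : Fin d → ℝ) : Measure (Fin d → ℝ) :=
  volume.withDensity fun y =>
    ENNReal.ofReal ((n : ℝ) ^ (-(d : ℝ) / 2) * gaussDens d p (delVec d n p y))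

/-- The regularized lower incomplete gamma function `γ̄(x, a)`. -/
def regGamma (x a : ℝ) : ℝ :=
  (∫ t in (0 : ℝ)..a, t ^ (x - 1) * Real.exp (-t)) / Real.Gamma x

/-- The inverse of `diag p - p pᵀ` when no coordinate of the extended vector vanishes. -/
theorem covM_inv (d : ℕ) (p : Fin d → ℝ) (hp : ∀ i, p i ≠ 0) (hs : 1 - ∑ i, p i ≠ 0) :
    (covM d p)⁻¹ =
      Matrix.diagonal (fun i => (p i)⁻¹) +
        (1 - ∑ i, p i)⁻¹ • Matrix.vecMulVec (fun _ => (1 : ℝ)) (fun _ => 1) := by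
  apply Matrix.inv_eq_right_inv
  rw [covM, Matrix.sub_mul, Matrix.mul_add, Matrix.mul_add]
  ext i j
  have hdot : p ⬝ᵥ (fun _ => (1 : ℝ)) = ∑ i, p i := by simp [dotProduct]
  simp only [Matrix.diagonal_mul_diagonal, Matrix.mul_smul, Matrix.vecMulVec_mul_vecMulVec, hdot,
    Matrix.sub_apply, Matrix.add_apply, Matrix.smul_apply, Matrix.diagonal_mul,
    Matrix.mul_diagonal, Matrix.vecMulVec_apply, smul_eq_mul, Pi.smul_apply, Matrix.one_apply,
    Matrix.diagonal_apply, mul_inv_cancel₀ (hp _)]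
  have hj := hp j
  split_ifs <;> field_simp <;> ring

/-- The quadratic form `x ↦ xᵀ Σ_p⁻¹ x` in coordinates. -/
theorem quadForm_eq (d : ℕ) (p x : Fin d → ℝ) (hp : ∀ i, p i ≠ 0) (hs : 1 - ∑ i, p i ≠ 0) :
    quadForm d p x = ∑ i, x i ^ 2 / p i + (∑ i, x i) ^ 2 / (1 - ∑ i, p i) := by
  have hdot : (fun _ => (1 : ℝ)) ⬝ᵥ x = ∑ i, x i := by simp [dotProduct]
  rw [quadForm, covM_inv d p hp hs, Matrix.add_mulVec, Matrix.smul_mulVec,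
    Matrix.vecMulVec_mulVec, dotProduct_add, hdot]
  congr 1
  · simp only [dotProduct, Matrix.mulVec_diagonal]
    exact Finset.sum_congr rfl fun i _ => by ring
  · simp only [dotProduct, Pi.smul_apply, smul_eq_mul, MulOpposite.smul_eq_mul_unop,
      MulOpposite.unop_op, one_mul, ← Finset.sum_mul]
    ring

/-- **Pearson's chi-square statistic as a normalized quadratic form**, via the inverse
formula `Σ_p⁻¹ = diag(p⁻¹) + p_{d+1}⁻¹ 1_d 1_dᵀ`. -/
theorem stmt9 (d n : ℕ) (p : Fin d → ℝ) (hp : p ∈ simplexInt d) (k : Fin d → ℝ) :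
    (covM d p)⁻¹ =
        Matrix.diagonal (fun i => (p i)⁻¹) +
          (1 - ∑ i, p i)⁻¹ • Matrix.vecMulVec (fun _ => (1 : ℝ)) (fun _ => 1) ∧
      quadForm d p (delVec d n p k) =
        ∑ i : Fin (d + 1), (extV d n k i - n * extP d p i) ^ 2 / (n * extP d p i) := by
  have hp0 : ∀ i, p i ≠ 0 := fun i => (hp.1 i).1.ne'
  have hs0 : 1 - ∑ i, p i ≠ 0 := (sub_pos.2 hp.2).ne'
  refine ⟨covM_inv d p hp0 hs0, ?_⟩
  have hn : Real.sqrt n ^ 2 = n := Real.sq_sqrt n.cast_nonneg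
  rw [quadForm_eq d p _ hp0 hs0, Fin.sum_univ_castSucc]
  simp only [extV, extP, Fin.snoc_castSucc, Fin.snoc_last, delVec, del]
  congr 1
  · refine Finset.sum_congr rfl fun i _ => ?_
    rw [div_pow, hn, div_div]
  · rw [← Finset.sum_div, div_pow, hn, div_div, Finset.sum_sub_distrib, ← Finset.mul_sum]
    congr 1
    ring
end
end

section
/- Let n ∈ ℕ with n ≥ 16, d ∈ ℕ, p ∈ S_d^o, and let ξ = (ξ_1,…,ξ_d) ~ Multinomial(n,p) with ξ_{d+1} := n − ‖ξ‖₁ and p_{d+1} := 1 − ‖p‖₁. Then for every Borel set B ⊆ ℝ^d and all 1 ≤ i ≤ d+1, | E[ δ_{ξ_i,p_i}³ · 1_{{ξ ∈ B}} ] − n^{−1/2} p_i (2 p_i² − 3 p_i + 1) | ≤ (1/√8) ( P(ξ ∈ B^c) )^{1/4}, where δ_{ξ_i,p_i} := (ξ_i − n p_i)/√n. -/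
open MeasureTheory Matrix Real Finset
open scoped BigOperators ENNReal NNReal

noncomputable section

section MultinomialWeights

variable {ι : Type*} [Fintype ι]

/-- The probability that a multinomial vector with cell probabilities `P` has counts `K`. -/
def multinomialWeight (P : ι → ℝ) (K : ι → ℕ) : ℝ :=
  Nat.multinomial univ K * ∏ j, P j ^ K j

lemma multinomialWeight_nonneg {P : ι → ℝ} (hP : ∀ j, 0 ≤ P j) (K : ι → ℕ) :
    0 ≤ multinomialWeight P K :=
  mul_nonneg (Nat.cast_nonneg _) (prod_nonneg fun j _ => pow_nonneg (hP j) _)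

variable [DecidableEq ι]

open Polynomial in
lemma sum_multinomialWeight_mul_X_pow {P : ι → ℝ} (hP : ∑ j, P j = 1) (n : ℕ) (i : ι) :
    ∑ K ∈ piAntidiag univ n, C (multinomialWeight P K) * (X : ℝ[X]) ^ K i =
      (C (P i) * X + C (1 - P i)) ^ n := by
  have hsum : ∑ j, C (P j) * (if j = i then (X : ℝ[X]) else 1) = C (P i) * X + C (1 - P i) := by
    rw [← add_sum_erase univ _ (mem_univ i), if_pos rfl, ← hP,
      ← add_sum_erase univ P (mem_univ i), add_sub_cancel_left, map_sum]
    congr 1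
    refine sum_congr rfl fun j hj => ?_
    rw [if_neg (ne_of_mem_erase hj), mul_one]
  rw [← hsum, sum_pow_eq_sum_piAntidiag]
  refine sum_congr rfl fun K _ => ?_
  have hX : ∏ j, (if j = i then (X : ℝ[X]) else 1) ^ K j = X ^ K i := by
    rw [prod_eq_single i] <;> simp +contextual
  simp only [mul_pow, prod_mul_distrib, hX, multinomialWeight, map_mul, map_prod, map_pow,
    map_natCast, mul_assoc]

open Polynomial in
lemma iterate_derivative_linear_pow (a b : ℝ) (n m : ℕ) :
    derivative^[m] ((C a * X + C b) ^ n) =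
      C ((n.descFactorial m : ℝ) * a ^ m) * (C a * X + C b) ^ (n - m) := by
  induction m with
  | zero => simp
  | succ m ih =>
    rw [Function.iterate_succ_apply', ih, derivative_C_mul, derivative_pow]
    simp [Nat.descFactorial_succ, ← Nat.sub_sub]
    ring

/-- The factorial moments of the counts of a multinomial vector. -/
lemma sum_multinomialWeight_mul_descFactorial {P : ι → ℝ} (hP : ∑ j, P j = 1) (n m : ℕ) (i : ι) :
    ∑ K ∈ piAntidiag univ n, multinomialWeight P K * ((K i).descFactorial m : ℝ) =
      (n.descFactorial m : ℝ) * P i ^ m := by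
  have h := congrArg (fun q => (Polynomial.derivative^[m] q).eval 1)
    (sum_multinomialWeight_mul_X_pow hP n i)
  rw [iterate_derivative_linear_pow] at h
  simpa [Polynomial.iterate_derivative_sum, Polynomial.eval_finsetSum,
    Polynomial.iterate_derivative_C_mul, Polynomial.iterate_derivative_X_pow_eq_natCast_mul]
    using h

lemma cast_descFactorial_three (a : ℕ) :
    (a.descFactorial 3 : ℝ) = a * (a - 1) * (a - 2) := by
  rw [← descPochhammer_eval_eq_descFactorial]
  simp [descPochhammer_succ_right]

lemma cast_descFactorial_four (a : ℕ) :
    (a.descFactorial 4 : ℝ) = a * (a - 1) * (a - 2) * (a - 3) := by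
  rw [← descPochhammer_eval_eq_descFactorial]
  simp [descPochhammer_succ_right]

lemma sum_multinomialWeight_mul_sub_pow_three {P : ι → ℝ} (hP : ∑ j, P j = 1) (n : ℕ) (i : ι) :
    ∑ K ∈ piAntidiag univ n, multinomialWeight P K * ((K i : ℝ) - n * P i) ^ 3 =
      n * P i * (2 * P i ^ 2 - 3 * P i + 1) := by
  have h := sum_multinomialWeight_mul_descFactorial hP n (i := i)
  set c : ℝ := n * P i with hc
  calc ∑ K ∈ piAntidiag univ n, multinomialWeight P K * ((K i : ℝ) - c) ^ 3
      = ∑ K ∈ piAntidiag univ n, multinomialWeight P K * ((K i).descFactorial 3 : ℝ)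
        + (3 - 3 * c) * ∑ K ∈ piAntidiag univ n,
            multinomialWeight P K * ((K i).descFactorial 2 : ℝ)
        + (1 - 3 * c + 3 * c ^ 2) * ∑ K ∈ piAntidiag univ n,
            multinomialWeight P K * ((K i).descFactorial 1 : ℝ)
        - c ^ 3 * ∑ K ∈ piAntidiag univ n,
            multinomialWeight P K * ((K i).descFactorial 0 : ℝ) := by
        simp only [mul_sum, ← sum_add_distrib, ← sum_sub_distrib]
        refine sum_congr rfl fun K _ => ?_
        rw [cast_descFactorial_three, Nat.cast_descFactorial_two, Nat.descFactorial_one,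
          Nat.descFactorial_zero]
        push_cast
        ring
    _ = _ := by
        rw [h, h, h, h, cast_descFactorial_three, Nat.cast_descFactorial_two,
          Nat.descFactorial_one, Nat.descFactorial_zero, hc]
        push_cast
        ring

lemma sum_multinomialWeight_mul_sub_pow_four {P : ι → ℝ} (hP : ∑ j, P j = 1) (n : ℕ) (i : ι) :
    ∑ K ∈ piAntidiag univ n, multinomialWeight P K * ((K i : ℝ) - n * P i) ^ 4 =
      3 * n ^ 2 * (P i * (1 - P i)) ^ 2 +
        n * (P i * (1 - P i)) * (1 - 6 * (P i * (1 - P i))) := by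
  have h := sum_multinomialWeight_mul_descFactorial hP n (i := i)
  set c : ℝ := n * P i with hc
  calc ∑ K ∈ piAntidiag univ n, multinomialWeight P K * ((K i : ℝ) - c) ^ 4
      = ∑ K ∈ piAntidiag univ n, multinomialWeight P K * ((K i).descFactorial 4 : ℝ)
        + (6 - 4 * c) * ∑ K ∈ piAntidiag univ n,
            multinomialWeight P K * ((K i).descFactorial 3 : ℝ)
        + (7 - 12 * c + 6 * c ^ 2) * ∑ K ∈ piAntidiag univ n,
            multinomialWeight P K * ((K i).descFactorial 2 : ℝ)
        + (1 - 4 * c + 6 * c ^ 2 - 4 * c ^ 3) * ∑ K ∈ piAntidiag univ n,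
            multinomialWeight P K * ((K i).descFactorial 1 : ℝ)
        + c ^ 4 * ∑ K ∈ piAntidiag univ n,
            multinomialWeight P K * ((K i).descFactorial 0 : ℝ) := by
        simp only [mul_sum, ← sum_add_distrib]
        refine sum_congr rfl fun K _ => ?_
        rw [cast_descFactorial_four, cast_descFactorial_three, Nat.cast_descFactorial_two,
          Nat.descFactorial_one, Nat.descFactorial_zero]
        push_cast
        ring
    _ = _ := by
        rw [h, h, h, h, h, cast_descFactorial_four, cast_descFactorial_three,
          Nat.cast_descFactorial_two, Nat.descFactorial_one, Nat.descFactorial_zero, hc]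
        push_cast
        ring

end MultinomialWeights

lemma sum_extP (d : ℕ) (p : Fin d → ℝ) : ∑ j, extP d p j = 1 := by
  simp [extP, Fin.sum_univ_castSucc]

lemma extP_nonneg {d : ℕ} {p : Fin d → ℝ} (hp : p ∈ simplexInt d) (j : Fin (d + 1)) :
    0 ≤ extP d p j := by
  refine Fin.lastCases ?_ (fun j => ?_) j
  · simpa [extP] using hp.2.le
  · simpa [extP] using (hp.1 j).1.le

lemma extP_le_one {d : ℕ} {p : Fin d → ℝ} (hp : p ∈ simplexInt d) (j : Fin (d + 1)) :
    extP d p j ≤ 1 :=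
  sum_extP d p ▸ single_le_sum (fun j _ => extP_nonneg hp j) (mem_univ j)

lemma multinomialWeight_extP {d n : ℕ} (p : Fin d → ℝ) {K : Fin (d + 1) → ℕ}
    (hK : ∑ j, K j = n) :
    multinomialWeight (extP d p) K = multinomialPMF d n p (Fin.init K) := by
  rw [Fin.sum_univ_castSucc] at hK
  have hlast : n - ∑ j, Fin.init K j = K (Fin.last d) := by
    simp only [Fin.init]; omega
  have hle : ∑ j, Fin.init K j ≤ n := by
    simp only [Fin.init]; omega
  rw [multinomialPMF, if_pos hle, hlast, multinomialWeight, Nat.multinomial,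
    Nat.cast_div (Nat.prod_factorial_dvd_factorial_sum _ _)
      (by exact_mod_cast prod_ne_zero_iff.2 fun j _ => Nat.factorial_ne_zero _)]
  simp [Fin.prod_univ_castSucc, Fin.sum_univ_castSucc, extP, Fin.init, hK]

lemma extV_castK_init {d n : ℕ} {K : Fin (d + 1) → ℕ} (hK : ∑ j, K j = n) (i : Fin (d + 1)) :
    extV d n (castK d (Fin.init K)) i = K i := by
  rw [Fin.sum_univ_castSucc] at hK
  refine Fin.lastCases ?_ (fun j => ?_) i
  · simp [extV, castK, Fin.init, ← hK]
  · simp [extV, castK, Fin.init]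

lemma tsum_multinomialPMF_mul (d n : ℕ) (p : Fin d → ℝ) (g : (Fin d → ℕ) → ℝ) :
    ∑' k, multinomialPMF d n p k * g k =
      ∑ K ∈ piAntidiag univ n, multinomialWeight (extP d p) K * g (Fin.init K) := by
  have hinj : Set.InjOn (Fin.init : (Fin (d + 1) → ℕ) → Fin d → ℕ)
      (piAntidiag (univ : Finset (Fin (d + 1))) n) := by
    intro K hK L hL h
    have hK' : ∑ j, K j = n := by simpa using hK
    have hL' : ∑ j, L j = n := by simpa using hL
    have hcast : ∀ j : Fin d, K j.castSucc = L j.castSucc := fun j => congrFun h j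
    funext j
    refine Fin.lastCases ?_ hcast j
    simp only [Fin.sum_univ_castSucc, hcast] at hK' hL'
    omega
  rw [tsum_eq_sum (s := (piAntidiag (univ : Finset (Fin (d + 1))) n).image Fin.init),
    sum_image hinj]
  · refine sum_congr rfl fun K hK => ?_
    rw [multinomialWeight_extP p (by simpa using hK)]
  · intro k hk
    rw [multinomialPMF, if_neg, zero_mul]
    intro hle
    refine hk (mem_image.2 ⟨Fin.snoc k (n - ∑ j, k j), ?_, Fin.init_snoc _ _⟩)
    simp [Fin.sum_univ_castSucc, hle]

/-- Hölder's inequality bounding a truncated third moment by the fourth moment. -/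
lemma abs_sum_mul_pow_three_mul_le {α : Type*} (s : Finset α) {w u δ : α → ℝ}
    (hw : ∀ a ∈ s, 0 ≤ w a) (hu : ∀ a, 0 ≤ u a) (hu1 : ∀ a, u a ≤ 1) {M : ℝ}
    (hM : ∑ a ∈ s, w a * δ a ^ 4 ≤ M) :
    |∑ a ∈ s, w a * δ a ^ 3 * u a| ≤
      M ^ ((3 : ℝ) / 4) * (∑ a ∈ s, w a * u a) ^ ((1 : ℝ) / 4) := by
  have habs : ∀ a ∈ s, |w a| = w a := fun a ha => abs_of_nonneg (hw a ha)
  have hpow : ∀ x : ℝ, (|x| ^ 3) ^ ((4 : ℝ) / 3) = x ^ 4 := fun x => by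
    rw [← rpow_natCast, ← rpow_mul (abs_nonneg x)]
    norm_num [Even.pow_abs (by decide : Even 4)]
  have holder := inner_le_weight_mul_Lp_of_nonneg s (p := 4 / 3) (by norm_num)
    (fun a => |w a| * u a) (fun a => |δ a| ^ 3)
    (fun a => mul_nonneg (abs_nonneg _) (hu a)) (fun a => by positivity)
  simp only [hpow] at holder
  have hW : ∑ a ∈ s, |w a| * u a = ∑ a ∈ s, w a * u a :=
    sum_congr rfl fun a ha => by rw [habs a ha]
  calc |∑ a ∈ s, w a * δ a ^ 3 * u a|
      ≤ ∑ a ∈ s, |w a * δ a ^ 3 * u a| := abs_sum_le_sum_abs _ _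
    _ = ∑ a ∈ s, |w a| * u a * |δ a| ^ 3 := sum_congr rfl fun a _ => by
        rw [abs_mul, abs_mul, abs_pow, abs_of_nonneg (hu a)]
        ring
    _ ≤ (∑ a ∈ s, w a * u a) ^ ((1 : ℝ) / 4) *
          (∑ a ∈ s, |w a| * u a * δ a ^ 4) ^ ((3 : ℝ) / 4) := by
        rw [← hW]
        convert holder using 2 <;> norm_num
    _ ≤ (∑ a ∈ s, w a * u a) ^ ((1 : ℝ) / 4) * M ^ ((3 : ℝ) / 4) := by
        have h0 : 0 ≤ ∑ a ∈ s, |w a| * u a * δ a ^ 4 := sum_nonneg fun a _ =>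
          mul_nonneg (mul_nonneg (abs_nonneg _) (hu a)) (by positivity)
        have h1 : 0 ≤ ∑ a ∈ s, w a * u a := sum_nonneg fun a ha => mul_nonneg (hw a ha) (hu a)
        refine mul_le_mul_of_nonneg_left
          (rpow_le_rpow h0 (le_trans (sum_le_sum fun a ha => ?_) hM) (by norm_num))
          (rpow_nonneg h1 _)
        rw [habs a ha]
        exact mul_le_mul_of_nonneg_right (mul_le_of_le_one_right (hw a ha) (hu1 a))
          (by positivity)
    _ = _ := mul_comm _ _

lemma quarter_rpow_three_quarters : ((1 : ℝ) / 4) ^ ((3 : ℝ) / 4) = 1 / √8 := by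
  have h8 : √8 = (2 : ℝ) ^ ((3 : ℝ) / 2) := by
    rw [sqrt_eq_rpow, show (8 : ℝ) = 2 ^ (3 : ℝ) by norm_num, ← rpow_mul (by norm_num)]
    norm_num
  rw [h8, show (1 : ℝ) / 4 = 2 ^ (-2 : ℝ) by norm_num [rpow_neg], ← rpow_mul (by norm_num),
    one_div, ← rpow_neg (by norm_num)]
  norm_num

lemma binomial_fourth_moment_le {n q : ℝ} (hn : 1 ≤ n) (hq0 : 0 ≤ q) (hq1 : q ≤ 1) :
    3 * n ^ 2 * (q * (1 - q)) ^ 2 + n * (q * (1 - q)) * (1 - 6 * (q * (1 - q))) ≤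
      n ^ 2 / 4 := by
  have hx0 : 0 ≤ q * (1 - q) := mul_nonneg hq0 (sub_nonneg.2 hq1)
  have hx : q * (1 - q) ≤ 1 / 4 := by nlinarith [sq_nonneg (q - 1 / 2)]
  set x := q * (1 - q)
  have hx2 : x ^ 2 ≤ 1 / 16 := by nlinarith
  have hquad : x * (1 - 6 * x) ≤ 1 / 24 := by nlinarith [sq_nonneg (x - 1 / 12)]
  have h1 := mul_le_mul_of_nonneg_left hx2 (sq_nonneg n)
  have h2 := mul_le_mul_of_nonneg_left hquad (by linarith : 0 ≤ n)
  nlinarith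

/-- **Lemma (third truncated moment bound for the multinomial distribution).** -/
theorem stmt12 (d n : ℕ) (hn : 16 ≤ n) (p : Fin d → ℝ) (hp : p ∈ simplexInt d)
    (B : Set (Fin d → ℝ)) (hB : MeasurableSet B) (i : Fin (d + 1)) :
    |(∑' k : Fin d → ℕ, multinomialPMF d n p k *
        del n (extP d p i) (extV d n (castK d k) i) ^ 3 *
        Set.indicator B (fun _ => (1 : ℝ)) (castK d k)) -
        (n : ℝ) ^ (-(1 : ℝ) / 2) * extP d p i *
          (2 * extP d p i ^ 2 - 3 * extP d p i + 1)| ≤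
      (1 / Real.sqrt 8) * (∑' k : Fin d → ℕ, multinomialPMF d n p k *
        Set.indicator Bᶜ (fun _ => (1 : ℝ)) (castK d k)) ^ ((1 : ℝ) / 4) := by
  classical
  set q := extP d p i with hq
  have hn0 : (0 : ℝ) < n := by exact_mod_cast (by omega : 0 < n)
  have hs : √(n : ℝ) ≠ 0 := (sqrt_pos.2 hn0).ne'
  have hs2 : √(n : ℝ) ^ 2 = n := sq_sqrt hn0.le
  have hs4 : √(n : ℝ) ^ 4 = (n : ℝ) ^ 2 := by
    rw [show √(n : ℝ) ^ 4 = (√(n : ℝ) ^ 2) ^ 2 by ring, hs2]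
  have hdel : ∀ K ∈ piAntidiag (univ : Finset (Fin (d + 1))) n,
      del n q (extV d n (castK d (Fin.init K)) i) = ((K i : ℝ) - n * q) / √n := fun K hK => by
    rw [extV_castK_init (by simpa using hK), del]
  have hnn : (n : ℝ) ^ (-(1 : ℝ) / 2) = n / √n ^ 3 := by
    rw [neg_div, rpow_neg hn0.le, ← sqrt_eq_rpow]
    field_simp
    rw [hs2]
  have hthree : ∑ K ∈ piAntidiag (univ : Finset (Fin (d + 1))) n,
      multinomialWeight (extP d p) K * del n q (extV d n (castK d (Fin.init K)) i) ^ 3 =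
        (n : ℝ) ^ (-(1 : ℝ) / 2) * q * (2 * q ^ 2 - 3 * q + 1) := by
    have h := sum_multinomialWeight_mul_sub_pow_three (sum_extP d p) n i
    rw [hnn, sum_congr rfl fun K hK => by rw [hdel K hK, div_pow, ← mul_div_assoc],
      ← sum_div, h]
    ring
  have hfour : ∑ K ∈ piAntidiag (univ : Finset (Fin (d + 1))) n,
      multinomialWeight (extP d p) K * del n q (extV d n (castK d (Fin.init K)) i) ^ 4 ≤
        1 / 4 := by
    have h := sum_multinomialWeight_mul_sub_pow_four (sum_extP d p) n i
    rw [sum_congr rfl fun K hK => by rw [hdel K hK, div_pow, ← mul_div_assoc],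
      ← sum_div, h, hs4, div_le_iff₀ (by positivity)]
    have hq := binomial_fourth_moment_le (n := n) (by exact_mod_cast (by omega : 1 ≤ n))
      (extP_nonneg hp i) (extP_le_one hp i)
    linarith
  have holder := abs_sum_mul_pow_three_mul_le (piAntidiag (univ : Finset (Fin (d + 1))) n)
    (u := fun K => Set.indicator Bᶜ (fun _ => (1 : ℝ)) (castK d (Fin.init K)))
    (fun K _ => multinomialWeight_nonneg (extP_nonneg hp) K)
    (fun K => Set.indicator_nonneg (fun _ _ => zero_le_one) _)
    (fun K => Set.indicator_le_self' (fun _ _ => zero_le_one) _) hfour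
  rw [quarter_rpow_three_quarters] at holder
  simp only [mul_assoc (multinomialPMF _ _ _ _)]
  rw [tsum_multinomialPMF_mul, tsum_multinomialPMF_mul, ← hthree, ← sum_sub_distrib]
  refine le_of_eq_of_le ?_ holder
  rw [← abs_neg, ← sum_neg_distrib]
  congr 1
  refine sum_congr rfl fun K _ => ?_
  by_cases hK : castK d (Fin.init K) ∈ B <;> simp [hK]
end
end
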